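/- Helplessness characterization: The center is helpless if and only if for every protocol F = (F_1,…,F_N), every zero-information strategy profile (s_1^r,…,s_N^r) with s_1^r,…,s_N^r ∈ S^r is an equilibrium of F. -/

import Mathlib

open scoped Classical
noncomputable section

/-- A strategy of an agent: `(p, q)` with `p = P(mᵢ = 0 ∣ bᵢ = 0)`, `q = P(mᵢ = 0 ∣ bᵢ = 1)`. -/
abbrev Strategy : Type := (Set.Icc (0:ℝ) 1) × (Set.Icc (0:ℝ) 1)

/-- The truthful strategy `sᵗ = (1,0)`. -/
def sT : Strategy := (⟨1, by norm_num⟩, ⟨0, by norm_num⟩)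

/-- A zero-information strategy: `p = q`. -/
def ZeroInfo (s : Strategy) : Prop := (s.1 : ℝ) = (s.2 : ℝ)

/-- Vectors of `N+1` bits (bits of the center and the `N` agents; also used for
message vectors and for the center's replies).  Coordinate `0` is the center. -/
abbrev Bits (N : ℕ) : Type := Fin (N+1) → Bool

/-- A strategy profile of the `N` agents. -/
abbrev Profile (N : ℕ) : Type := Fin N → Strategy

/-- A protocol for a single agent: a map from strategy profiles and message vectors to
distributions over replies `f ∈ {0,1}^{N+1}`. -/
abbrev Protocol (N : ℕ) : Type := Profile N → Bits N → PMF (Bits N)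

/-- `P(message = msg ∣ bit = bit)` under strategy `s` (where `false` plays the role of `0`). -/
def strandP (s : Strategy) (bit msg : Bool) : ℝ :=
  if msg then 1 - (if bit then (s.2 : ℝ) else (s.1 : ℝ))
  else (if bit then (s.2 : ℝ) else (s.1 : ℝ))

/-- `P(messages = m ∣ bits = b)` under profile `s`; the center's message is her own bit. -/
def msgP {N : ℕ} (s : Profile N) (b m : Bits N) : ℝ :=
  (if m 0 = b 0 then (1:ℝ) else 0) * ∏ i : Fin N, strandP (s i) (b i.succ) (m i.succ)

/-- Joint probability of bits `b`, messages `m` and reply `f` (to the relevant agent),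
under profile `s` and protocol `F`; bits are i.i.d. uniform. -/
def jointP {N : ℕ} (s : Profile N) (F : Protocol N) (b m f : Bits N) : ℝ :=
  ((1:ℝ)/2)^(N+1) * msgP s b m * ((F s m) f).toReal

/-- `P(bᵢ = bi, mᵢ = mi, fᵢ = f, g(b) = val)` for agent `i` (coordinate `i.succ`). -/
def pObs {N : ℕ} (g : Bits N → Bool) (s : Profile N) (F : Protocol N) (i : Fin N)
    (bi mi : Bool) (f : Bits N) (val : Bool) : ℝ :=
  ∑ b : Bits N, ∑ m : Bits N,
    if b i.succ = bi ∧ m i.succ = mi ∧ g b = val then jointP s F b m f else 0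

/-- `P(bᵢ = bi, mᵢ = mi, fᵢ = f)` for agent `i`. -/
def pObsAll {N : ℕ} (s : Profile N) (F : Protocol N) (i : Fin N)
    (bi mi : Bool) (f : Bits N) : ℝ :=
  ∑ b : Bits N, ∑ m : Bits N,
    if b i.succ = bi ∧ m i.succ = mi then jointP s F b m f else 0

/-- `P(b_k = 1, bᵢ = bi, mᵢ = mi, fᵢ = f)` for agent `i`. -/
def pBit {N : ℕ} (s : Profile N) (F : Protocol N) (i : Fin N)
    (bi mi : Bool) (f : Bits N) (k : Fin (N+1)) : ℝ :=
  ∑ b : Bits N, ∑ m : Bits N,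
    if b i.succ = bi ∧ m i.succ = mi ∧ b k = true then jointP s F b m f else 0

/-- The posterior `v_k = P(b_k = 1 ∣ fᵢ, mᵢ, bᵢ)` of agent `i` at the realization
`(bi, mi, f)`. -/
def post {N : ℕ} (s : Profile N) (F : Protocol N) (i : Fin N)
    (bi mi : Bool) (f : Bits N) (k : Fin (N+1)) : ℝ :=
  pBit s F i bi mi f k / pObsAll s F i bi mi f

/-- Expected profit `V_i(s⃗; F_i)`: after observing `(bᵢ, mᵢ, fᵢ)` the agent guesses the
more likely value of `g(b)` (uniformly at random in case of a tie) and earns `c i` iff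
the guess is correct. -/
def V {N : ℕ} (g : Bits N → Bool) (c : Fin N → ℝ) (s : Profile N) (F : Protocol N)
    (i : Fin N) : ℝ :=
  c i * ∑ bi : Bool, ∑ mi : Bool, ∑ f : Bits N,
    (if pObs g s F i bi mi f true > pObs g s F i bi mi f false then pObs g s F i bi mi f true
     else if pObs g s F i bi mi f false > pObs g s F i bi mi f true then
       pObs g s F i bi mi f false
     else (pObs g s F i bi mi f false + pObs g s F i bi mi f true) / 2)

/-- Utility `U_i(s⃗; F_i) = V_i(s⃗; F_i) − priceᵢ(sᵢ)`. -/
def U {N : ℕ} (g : Bits N → Bool) (c : Fin N → ℝ) (price : Fin N → Strategy → ℝ)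
    (s : Profile N) (F : Protocol N) (i : Fin N) : ℝ :=
  V g c s F i - price i (s i)

/-- The all-truthful profile `(sᵗ, …, sᵗ)`. -/
def truthProfile (N : ℕ) : Profile N := fun _ => sT

/-- `s⃗` is an equilibrium of the protocol `F = (F_1,…,F_N)`. -/
def Equilibrium {N : ℕ} (g : Bits N → Bool) (c : Fin N → ℝ) (price : Fin N → Strategy → ℝ)
    (s : Profile N) (FF : Fin N → Protocol N) : Prop :=
  ∀ i : Fin N, ∀ s' : Strategy,
    U g c price s (FF i) i ≥ U g c price (Function.update s i s') (FF i) i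

/-- The improvement `F_i⁺` of a protocol `F_i`: it agrees with `F_i` when `s_i` is a
zero-information strategy, and otherwise returns the reply whose first coordinate is
`m₀ = b₀` and whose remaining coordinates are those of `F_i`'s reply. -/
def improve {N : ℕ} (i : Fin N) (F : Protocol N) : Protocol N := fun s m =>
  if ZeroInfo (s i) then F s m
  else PMF.map (fun f => Function.update f 0 (m 0)) (F s m)

/-- The center is helpless. -/
def Helpless (N : ℕ) (g : Bits N → Bool) (c : Fin N → ℝ)
    (price : Fin N → Strategy → ℝ) : Prop :=
  ∀ i : Fin N, ∀ F : Protocol N, ∀ si : Strategy, ¬ ZeroInfo si →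
    ∀ sr : Profile N, (∀ j, ZeroInfo (sr j)) →
      U g c price sr F i ≥ U g c price (Function.update sr i si) (improve i F) i

/-- Relative price `price_i^r(s_i) = price_i(s_i) / price_i(sᵗ)`. -/
def priceR {N : ℕ} (price : Fin N → Strategy → ℝ) (i : Fin N) (s : Strategy) : ℝ :=
  price i s / price i sT

/-- The competitive protocol (the component `F_i^c` for agent `i`). -/
def Fc {N : ℕ} (price : Fin N → Strategy → ℝ) (i : Fin N) : Protocol N := fun s m =>
  if ∀ j, s j = sT then PMF.pure m
  else if ∀ j, j ≠ i → priceR price j (s j) < priceR price i (s i) then PMF.pure m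
  else PMF.uniformOfFintype (Bits N)

/-- The protocol that always replies the full message vector `m = (b₀, m₁, …, m_N)`. -/
def Fmax (N : ℕ) : Protocol N := fun _ m => PMF.pure m

/-- The protocol that always replies `N+1` independent uniform random bits. -/
def Fmin (N : ℕ) : Protocol N := fun _ _ => PMF.uniformOfFintype (Bits N)

/-- Agent `i` is fanatic. -/
def Fanatic {N : ℕ} (g : Bits N → Bool) (c : Fin N → ℝ) (price : Fin N → Strategy → ℝ)
    (i : Fin N) : Prop :=
  ∀ s : Profile N,
    price i sT > V g c (truthProfile N) (Fmax N) i - V g c s (Fmin N) i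

/-- The fair competitive protocol (the component `F_i^{fc}` for agent `i`). -/
def Ffc {N : ℕ} (price : Fin N → Strategy → ℝ) (i : Fin N) : Protocol N := fun s m =>
  if s i = sT then PMF.pure m
  else if (∃ j, j ≠ i ∧ s j ≠ sT) ∧
      (∀ j, j ≠ i → s j ≠ sT → priceR price j (s j) < priceR price i (s i)) then PMF.pure m
  else PMF.uniformOfFintype (Bits N)

/-- The profit is the expected maximum of the two joint probabilities. -/
theorem V_eq_sum_max {N : ℕ} (g : Bits N → Bool) (c : Fin N → ℝ) (s : Profile N)
    (F : Protocol N) (i : Fin N) :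
    V g c s F i = c i * ∑ bi : Bool, ∑ mi : Bool, ∑ f : Bits N,
      max (pObs g s F i bi mi f true) (pObs g s F i bi mi f false) := by
  unfold V
  congr 1
  refine Finset.sum_congr rfl fun bi _ => Finset.sum_congr rfl fun mi _ =>
    Finset.sum_congr rfl fun f _ => ?_
  split_ifs with h₁ h₂
  · exact (max_eq_left h₁.le).symm
  · exact (max_eq_right h₂.le).symm
  · have h := le_antisymm (not_lt.1 h₁) (not_lt.1 h₂)
    rw [h, max_self]
    ring

theorem pObs_Fmax {N : ℕ} (g : Bits N → Bool) (s : Profile N) (i : Fin N) (bi mi : Bool)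
    (m : Bits N) (val : Bool) :
    pObs g s (Fmax N) i bi mi m val = ∑ b : Bits N,
      if b i.succ = bi ∧ m i.succ = mi ∧ g b = val then ((1:ℝ)/2)^(N+1) * msgP s b m else 0 := by
  unfold pObs jointP Fmax
  refine Finset.sum_congr rfl fun b _ => ?_
  rw [Finset.sum_eq_single m]
  · simp [PMF.pure_apply]
  · intro m' _ hm
    simp [PMF.pure_apply, hm.symm]
  · simp

/-- Any protocol is a garbling of the protocol that reveals all messages. -/
theorem pObs_eq_sum_Fmax {N : ℕ} (g : Bits N → Bool) (s : Profile N) (F : Protocol N)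
    (i : Fin N) (bi mi : Bool) (f : Bits N) (val : Bool) :
    pObs g s F i bi mi f val =
      ∑ m : Bits N, pObs g s (Fmax N) i bi mi m val * (F s m f).toReal := by
  simp only [pObs_Fmax, Finset.sum_mul]
  rw [Finset.sum_comm]
  unfold pObs jointP
  refine Finset.sum_congr rfl fun b _ => Finset.sum_congr rfl fun m _ => ?_
  rw [ite_mul, zero_mul]

theorem PMF.sum_toReal {α : Type*} [Fintype α] (p : PMF α) : ∑ a, (p a).toReal = 1 := by
  rw [← ENNReal.toReal_sum fun a _ => p.apply_ne_top a, ← tsum_fintype (L := .unconditional α),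
    p.tsum_coe, ENNReal.toReal_one]

theorem V_le_V_Fmax {N : ℕ} (g : Bits N → Bool) (c : Fin N → ℝ) (s : Profile N)
    (F : Protocol N) (i : Fin N) (hc : 0 ≤ c i) : V g c s F i ≤ V g c s (Fmax N) i := by
  rw [V_eq_sum_max, V_eq_sum_max]
  refine mul_le_mul_of_nonneg_left
    (Finset.sum_le_sum fun bi _ => Finset.sum_le_sum fun mi _ => ?_) hc
  calc ∑ f : Bits N, max (pObs g s F i bi mi f true) (pObs g s F i bi mi f false)
      ≤ ∑ f : Bits N, ∑ m : Bits N, max (pObs g s (Fmax N) i bi mi m true)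
          (pObs g s (Fmax N) i bi mi m false) * (F s m f).toReal := by
        refine Finset.sum_le_sum fun f _ => ?_
        rw [pObs_eq_sum_Fmax g s F i bi mi f true, pObs_eq_sum_Fmax g s F i bi mi f false]
        exact max_le
          (Finset.sum_le_sum fun m _ =>
            mul_le_mul_of_nonneg_right (le_max_left _ _) ENNReal.toReal_nonneg)
          (Finset.sum_le_sum fun m _ =>
            mul_le_mul_of_nonneg_right (le_max_right _ _) ENNReal.toReal_nonneg)
    _ = _ := by
        rw [Finset.sum_comm]
        simp only [← Finset.mul_sum, PMF.sum_toReal, mul_one]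

/-- The profit depends on the protocol only through its values at the played profile. -/
theorem V_congr {N : ℕ} (g : Bits N → Bool) (c : Fin N → ℝ) {s : Profile N} {F F' : Protocol N}
    (i : Fin N) (h : F s = F' s) : V g c s F i = V g c s F' i := by
  simp only [V_eq_sum_max, pObs, jointP, h]

theorem continuous_strandP (bit msg : Bool) : Continuous fun s : Strategy => strandP s bit msg := by
  cases bit <;> cases msg <;> simp only [strandP, if_true, Bool.false_eq_true, if_false] <;> fun_prop

theorem continuous_V_Fmax {N : ℕ} (g : Bits N → Bool) (c : Fin N → ℝ) (i : Fin N) :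
    Continuous fun s : Profile N => V g c s (Fmax N) i := by
  have hobs (bi mi : Bool) (m : Bits N) (val : Bool) :
      Continuous fun s : Profile N => pObs g s (Fmax N) i bi mi m val := by
    simp only [pObs_Fmax]
    refine continuous_finsetSum _ fun b _ => ?_
    split_ifs
    · unfold msgP
      exact continuous_const.mul (continuous_const.mul (continuous_finsetProd _ fun j _ =>
        (continuous_strandP _ _).comp (continuous_apply j)))
    · exact continuous_const
  simp only [V_eq_sum_max]
  exact continuous_const.mul (continuous_finsetSum _ fun bi _ => continuous_finsetSum _
    fun mi _ => continuous_finsetSum _ fun f _ => (hobs bi mi f true).max (hobs bi mi f false))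

theorem dense_not_zeroInfo : Dense {s : Strategy | ¬ ZeroInfo s} := by
  rintro ⟨p, q⟩
  have hq : q ∈ closure ({p}ᶜ : Set (Set.Icc (0:ℝ) 1)) := dense_compl_singleton p q
  refine map_mem_closure (f := fun x => (p, x)) (by fun_prop) hq fun x hx => ?_
  exact fun h => hx (Subtype.ext h.symm)

theorem improve_Fmax_apply {N : ℕ} {F : Protocol N} {s : Profile N} (i : Fin N)
    (h : F s = Fmax N s) : improve i F s = Fmax N s := by
  funext m
  simp [improve, h, Fmax, PMF.pure_map]

/-- Helplessness characterization. -/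
theorem helpless_iff_zeroinfo_equilibria (N : ℕ) (hN : 2 ≤ N) (g : Bits N → Bool) (c : Fin N → ℝ)
    (hc : ∀ i, 0 < c i)
    (price : Fin N → Strategy → ℝ)
    (hpriceCont : ∀ i, Continuous (price i))
    (hprice0 : ∀ i s, ZeroInfo s → price i s = 0)
    (hpricePos : ∀ i s, ¬ ZeroInfo s → 0 < price i s)
    (hpriceMax : ∀ i s, price i s ≤ price i sT) :
    Helpless N g c price ↔
      ∀ FF : Fin N → Protocol N, ∀ sr : Profile N, (∀ j, ZeroInfo (sr j)) →
        Equilibrium g c price sr FF := by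
  constructor
  · intro hH FF sr hsr i s'
    set C := U g c price sr (FF i) i
    have key : ∀ si : Strategy,
        U g c price (Function.update sr i si) (Fmax N) i ≤ C := by
      have hcont : Continuous fun si => U g c price (Function.update sr i si) (Fmax N) i := by
        simp only [U, Function.update_self]
        exact ((continuous_V_Fmax g c i).comp (continuous_const.update i continuous_id)).sub
          (hpriceCont i)
      have hclosed : IsClosed {si | U g c price (Function.update sr i si) (Fmax N) i ≤ C} :=
        isClosed_le hcont continuous_const
      refine fun si => hclosed.closure_subset_iff.2 (fun t ht => ?_) (dense_not_zeroInfo si)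
      let F : Protocol N := fun s => if s = sr then FF i sr else Fmax N s
      have hne : Function.update sr i t ≠ sr := fun h =>
        ht (Function.update_eq_self_iff.1 h ▸ hsr i)
      have hF : F (Function.update sr i t) = Fmax N (Function.update sr i t) := if_neg hne
      have h := hH i F t ht sr hsr
      rwa [U, U, V_congr g c i (if_pos rfl : F sr = FF i sr),
        V_congr g c i (improve_Fmax_apply i hF)] at h
    exact (sub_le_sub_right (V_le_V_Fmax g c _ (FF i) i (hc i).le) _).trans (key s')
  · intro hE i F si _ sr hsr
    have h := hE (fun _ => improve i F) sr hsr i si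
    rwa [U, V_congr g c i (funext fun m => if_pos (hsr i) : improve i F sr = F sr)] at h

end
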